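/- arXiv:2206.13094 — 3 statements merged into one kernel-verified Lean document; each statement's English description precedes it below -/
import Mathlib

section
/- Let M = [[A,B],[C,D]] be a 2N×2N real free symplectic matrix (A·Bᵀ = B·Aᵀ, C·Dᵀ = D·Cᵀ, A·Dᵀ − B·Cᵀ = I_N, det B ≠ 0) and let f : ℝᴺ → ℂ be a Schwartz function. Then the inversion formula for the free metaplectic transform holds: for every t ∈ ℝᴺ, f(t) = |det B|^(−1/2) ∫_{ℝᴺ} L_M[f](u) · exp(−πi (u B⁻ᵀ Dᵀ uᵀ + t Aᵀ B⁻ᵀ tᵀ) + 2πi u B⁻ᵀ tᵀ) du, i.e. f = L_{M⁻¹}[L_M[f]] where M⁻¹ = [[Dᵀ, −Bᵀ],[−Cᵀ, Aᵀ]]. -/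
open MeasureTheory Matrix Complex

/-- The free metaplectic transform (FMT) of `f : ℝᴺ → ℂ` with respect to the blocks
`A`, `B`, `D` of a free symplectic matrix `M = [[A,B],[C,D]]`:
`L_M[f](u) = |det B|^(−1/2) ∫ f(t) · exp(πi(u D B⁻¹ uᵀ + t B⁻¹ A tᵀ) − 2πi t B⁻¹ uᵀ) dt`. -/
noncomputable def fmt {N : ℕ} (A B D : Matrix (Fin N) (Fin N) ℝ)
    (f : (Fin N → ℝ) → ℂ) (u : Fin N → ℝ) : ℂ :=
  (((Real.sqrt |B.det|)⁻¹ : ℝ) : ℂ) *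
    ∫ t : Fin N → ℝ,
      f t * Complex.exp (↑Real.pi * Complex.I *
          (↑(u ⬝ᵥ ((D * B⁻¹) *ᵥ u)) + ↑(t ⬝ᵥ ((B⁻¹ * A) *ᵥ t)))
        - 2 * ↑Real.pi * Complex.I * ↑(t ⬝ᵥ (B⁻¹ *ᵥ u)))

/-- The `M`-generalized translation of `g` by `τ`:
`g(t θ τ) = |det B|⁻¹ ∫ L_M[g](u) · exp(πi(τ B⁻¹ A τᵀ − t B⁻¹ A tᵀ) + 2πi (t−τ) B⁻¹ uᵀ) du`. -/
noncomputable def genTrans {N : ℕ} (A B D : Matrix (Fin N) (Fin N) ℝ)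
    (g : (Fin N → ℝ) → ℂ) (t τ : Fin N → ℝ) : ℂ :=
  ((|B.det|⁻¹ : ℝ) : ℂ) *
    ∫ u : Fin N → ℝ,
      fmt A B D g u * Complex.exp (↑Real.pi * Complex.I *
          (↑(τ ⬝ᵥ ((B⁻¹ * A) *ᵥ τ)) - ↑(t ⬝ᵥ ((B⁻¹ * A) *ᵥ t)))
        + 2 * ↑Real.pi * Complex.I * ↑((t - τ) ⬝ᵥ (B⁻¹ *ᵥ u)))

theorem iteratedDeriv_cexp_ofReal_mul_I (n : ℕ) :
    iteratedDeriv n (fun x : ℝ ↦ cexp (x * I)) = fun x : ℝ ↦ I ^ n * cexp (x * I) := by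
  induction n with
  | zero => simp
  | succ n ih =>
    rw [iteratedDeriv_succ, ih]
    ext x
    have h : HasDerivAt (fun x : ℝ ↦ cexp (x * I)) (cexp (x * I) * (1 * I)) x :=
      (((hasDerivAt_id (x : ℂ)).mul_const I).cexp).comp_ofReal
    rw [(h.const_mul (I ^ n)).deriv]
    ring

theorem hasTemperateGrowth_cexp_ofReal_mul_I :
    (fun x : ℝ ↦ cexp (x * I)).HasTemperateGrowth := by
  refine ⟨(ofRealCLM.contDiff.mul contDiff_const).cexp, fun n ↦ ⟨0, 1, fun x ↦ ?_⟩⟩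
  rw [norm_iteratedFDeriv_eq_norm_iteratedDeriv, iteratedDeriv_cexp_ofReal_mul_I]
  simp [norm_exp_ofReal_mul_I]

theorem hasTemperateGrowth_dotProduct_mulVec {ι : Type*} [Fintype ι] (Q : Matrix ι ι ℝ) :
    (fun x : ι → ℝ ↦ x ⬝ᵥ (Q *ᵥ x)).HasTemperateGrowth := by
  have hcoord (i : ι) : (fun x : ι → ℝ ↦ x i).HasTemperateGrowth :=
    (ContinuousLinearMap.proj (R := ℝ) (φ := fun _ : ι ↦ ℝ) i).hasTemperateGrowth
  simp only [dotProduct, mulVec]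
  exact .sum fun i _ ↦ (hcoord i).fun_mul <| .sum fun j _ ↦
    (Function.HasTemperateGrowth.const _).fun_mul (hcoord j)

/-- The quadratic chirp `x ↦ exp(πi x Q xᵀ)`. -/
noncomputable def chirp {ι : Type*} [Fintype ι] (Q : Matrix ι ι ℝ) (x : ι → ℝ) : ℂ :=
  cexp (Real.pi * I * ↑(x ⬝ᵥ (Q *ᵥ x)))

theorem hasTemperateGrowth_chirp {ι : Type*} [Fintype ι] (Q : Matrix ι ι ℝ) :
    (chirp Q).HasTemperateGrowth := by
  have h : (fun x : ι → ℝ ↦ Real.pi * (x ⬝ᵥ (Q *ᵥ x))).HasTemperateGrowth :=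
    (Function.HasTemperateGrowth.const Real.pi).fun_mul (hasTemperateGrowth_dotProduct_mulVec Q)
  convert hasTemperateGrowth_cexp_ofReal_mul_I.comp h using 1
  ext x
  simp only [chirp, Function.comp_apply]
  push_cast
  ring_nf

/-- The Fourier integral on `ι → ℝ` written with the dot product. -/
noncomputable def dotFourier {ι : Type*} [Fintype ι] (g : (ι → ℝ) → ℂ) (w : ι → ℝ) : ℂ :=
  ∫ s : ι → ℝ, cexp (-(2 * Real.pi * I * ↑(s ⬝ᵥ w))) * g s

theorem fourier_ofLp_comp {ι : Type*} [Fintype ι] (g : (ι → ℝ) → ℂ)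
    (w : EuclideanSpace ℝ ι) :
    FourierTransform.fourier (fun x : EuclideanSpace ℝ ι ↦ g x.ofLp) w = dotFourier g w.ofLp := by
  rw [Real.fourier_eq', dotFourier, ← (PiLp.volume_preserving_toLp ι).integral_comp
    (MeasurableEquiv.toLp 2 _).measurableEmbedding]
  refine integral_congr_ae (.of_forall fun s ↦ ?_)
  simp only [smul_eq_mul, EuclideanSpace.inner_eq_star_dotProduct, star_trivial]
  rw [dotProduct_comm w.ofLp s]
  push_cast
  ring_nf

theorem dotFourier_inversion {ι : Type*} [Fintype ι] (g : SchwartzMap (ι → ℝ) ℂ) (t : ι → ℝ) :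
    ∫ w : ι → ℝ, cexp (2 * Real.pi * I * ↑(t ⬝ᵥ w)) * dotFourier g w = g t := by
  let G : SchwartzMap (EuclideanSpace ℝ ι) ℂ :=
    SchwartzMap.compCLMOfContinuousLinearEquiv ℂ (EuclideanSpace.equiv ι ℝ) g
  have hG : FourierTransformInv.fourierInv (FourierTransform.fourier (G : EuclideanSpace ℝ ι → ℂ))
      = G := by
    rw [← SchwartzMap.fourier_coe, ← SchwartzMap.fourierInv_coe,
      FourierTransform.fourierInv_fourier_eq]
  have hfour (w : EuclideanSpace ℝ ι) :
      FourierTransform.fourier (G : EuclideanSpace ℝ ι → ℂ) w = dotFourier g w.ofLp :=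
    fourier_ofLp_comp g w
  have h := congrFun hG (WithLp.toLp 2 t)
  rw [Real.fourierInv_eq', ← (PiLp.volume_preserving_toLp ι).integral_comp
    (MeasurableEquiv.toLp 2 _).measurableEmbedding] at h
  refine Eq.trans (integral_congr_ae (.of_forall fun w ↦ ?_)) h
  simp only [hfour, smul_eq_mul, EuclideanSpace.inner_eq_star_dotProduct, star_trivial]
  push_cast
  ring_nf

theorem integral_comp_mulVec {ι : Type*} [Fintype ι] [DecidableEq ι] {M : Matrix ι ι ℝ}
    (hM : M.det ≠ 0) (F : (ι → ℝ) → ℂ) :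
    ∫ u : ι → ℝ, F (M *ᵥ u) = ((|M.det|⁻¹ : ℝ) : ℂ) * ∫ w : ι → ℝ, F w := by
  have hemb : MeasurableEmbedding (toLin' M) :=
    (LinearEquiv.ofIsUnitDet (f := toLin' M) (v := Pi.basisFun ℝ ι) (v' := Pi.basisFun ℝ ι)
      (by simpa [LinearMap.toMatrix_eq_toMatrix'] using hM.isUnit)
      ).toContinuousLinearEquiv.toHomeomorph.measurableEmbedding
  have h := hemb.integral_map (μ := volume) F
  rw [Real.map_matrix_volume_pi_eq_smul_volume_pi hM, integral_smul_measure,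
    ENNReal.toReal_ofReal (abs_nonneg _), abs_inv] at h
  simpa [toLin'_apply] using h.symm

theorem fmt_eq_dotFourier {N : ℕ} (A B D : Matrix (Fin N) (Fin N) ℝ)
    (f : (Fin N → ℝ) → ℂ) (u : Fin N → ℝ) :
    fmt A B D f u = (((Real.sqrt |B.det|)⁻¹ : ℝ) : ℂ) * chirp (D * B⁻¹) u *
      dotFourier (fun s ↦ chirp (B⁻¹ * A) s * f s) (B⁻¹ *ᵥ u) := by
  rw [fmt, dotFourier, mul_assoc _ (chirp _ u), ← integral_const_mul (chirp (D * B⁻¹) u)]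
  congr 2
  ext s
  simp only [chirp]
  rw [sub_eq_add_neg, mul_add, exp_add, exp_add]
  ring

theorem dotProduct_transpose_mulVec_comm {ι κ : Type*} [Fintype ι] [Fintype κ]
    (Q : Matrix ι κ ℝ) (x : κ → ℝ) (y : ι → ℝ) :
    x ⬝ᵥ (Qᵀ *ᵥ y) = y ⬝ᵥ (Q *ᵥ x) := by
  rw [mulVec_transpose, dotProduct_comm, dotProduct_mulVec]

/-- Inversion formula for the FMT: for a free symplectic matrix
`M = [[A,B],[C,D]]` and a Schwartz function `f`, `f = L_{M⁻¹}[L_M[f]]`, explicitly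
`f(t) = |det B|^(−1/2) ∫ L_M[f](u) · exp(−πi(u B⁻ᵀ Dᵀ uᵀ + t Aᵀ B⁻ᵀ tᵀ) + 2πi u B⁻ᵀ tᵀ) du`. -/
theorem fmt_inversion {N : ℕ} (A B C D : Matrix (Fin N) (Fin N) ℝ)
    (h1 : A * Bᵀ = B * Aᵀ) (h2 : C * Dᵀ = D * Cᵀ)
    (h3 : A * Dᵀ - B * Cᵀ = 1) (hB : B.det ≠ 0)
    (f : SchwartzMap ((Fin N) → ℝ) ℂ) (t : Fin N → ℝ) :
    f t = (((Real.sqrt |B.det|)⁻¹ : ℝ) : ℂ) *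
      ∫ u : Fin N → ℝ,
        fmt A B D (⇑f) u * Complex.exp (-(↑Real.pi * Complex.I *
            (↑(u ⬝ᵥ (((B⁻¹)ᵀ * Dᵀ) *ᵥ u)) + ↑(t ⬝ᵥ ((Aᵀ * (B⁻¹)ᵀ) *ᵥ t))))
          + 2 * ↑Real.pi * Complex.I * ↑(u ⬝ᵥ ((B⁻¹)ᵀ *ᵥ t))) := by
  let g : SchwartzMap (Fin N → ℝ) ℂ := SchwartzMap.smulLeftCLM ℂ (chirp (B⁻¹ * A)) f
  have hg : (fun s ↦ chirp (B⁻¹ * A) s * f s) = g := by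
    ext s
    simp [g, hasTemperateGrowth_chirp]
  have hdet : (B⁻¹).det ≠ 0 := by simpa [det_nonsing_inv] using hB
  have hint (u : Fin N → ℝ) :
      fmt A B D f u * cexp (-(Real.pi * I *
          (↑(u ⬝ᵥ (((B⁻¹)ᵀ * Dᵀ) *ᵥ u)) + ↑(t ⬝ᵥ ((Aᵀ * (B⁻¹)ᵀ) *ᵥ t))))
        + 2 * Real.pi * I * ↑(u ⬝ᵥ ((B⁻¹)ᵀ *ᵥ t))) =
      (((Real.sqrt |B.det|)⁻¹ : ℝ) : ℂ) * (chirp (B⁻¹ * A) t)⁻¹ *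
        (cexp (2 * Real.pi * I * ↑(t ⬝ᵥ (B⁻¹ *ᵥ u))) * dotFourier g (B⁻¹ *ᵥ u)) := by
    rw [fmt_eq_dotFourier, hg, ← transpose_mul, ← transpose_mul]
    simp only [dotProduct_transpose_mulVec_comm]
    rw [mul_add, neg_add, exp_add, exp_add, exp_neg, exp_neg, ← chirp, ← chirp]
    have hne : chirp (D * B⁻¹) u ≠ 0 := exp_ne_zero _
    field_simp
  simp_rw [hint]
  rw [integral_const_mul, integral_comp_mulVec hdet
    (fun w ↦ cexp (2 * Real.pi * I * ↑(t ⬝ᵥ w)) * dotFourier g w), dotFourier_inversion, ← hg]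
  have hne : chirp (B⁻¹ * A) t ≠ 0 := exp_ne_zero _
  have hsqrt : ((Real.sqrt |B.det| : ℝ) : ℂ) ^ 2 = (|B.det| : ℝ) := by
    rw [← ofReal_pow, Real.sq_sqrt (abs_nonneg _)]
  have hpos : ((|B.det| : ℝ) : ℂ) ≠ 0 := by simpa using hB
  have hsne : ((Real.sqrt |B.det| : ℝ) : ℂ) ≠ 0 := fun h ↦ hpos (by rw [← hsqrt, h]; simp)
  rw [det_nonsing_inv, Ring.inverse_eq_inv', abs_inv, inv_inv, ← hsqrt]
  push_cast
  field_simp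
end

section
/- Let M = [[A,B],[C,D]] be a 2N×2N real free symplectic matrix (A·Bᵀ = B·Aᵀ, C·Dᵀ = D·Cᵀ, A·Dᵀ − B·Cᵀ = I_N, det B ≠ 0) and let f, g : ℝᴺ → ℂ be Schwartz functions. Define z(t) = (f ⋆^M g)(t) = ∫_{ℝᴺ} f(τ) · g(t θ τ) dτ, where g(t θ τ) is the M-generalized translation of g. Then z is recovered by the inverse FMT of the product of the spectra: for every t ∈ ℝᴺ, z(t) = |det B|^(−1/2) ∫_{ℝᴺ} L_M[f](u) · L_M[g](u) · exp(−πi (u B⁻ᵀ Dᵀ uᵀ + t Aᵀ B⁻ᵀ tᵀ) + 2πi u B⁻ᵀ tᵀ) du. -/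
open MeasureTheory Matrix Complex

/-- The unit-modulus exponential `x ↦ exp (x i)` on the real line has temperate growth. -/
theorem hasTemperateGrowth_cexp_ofReal_mul_I_s4 :
    Function.HasTemperateGrowth (fun x : ℝ => Complex.exp (x * Complex.I)) := by
  have hder (n : ℕ) : iteratedDeriv n (fun x : ℝ => Complex.exp (x * Complex.I)) =
      fun x : ℝ => Complex.I ^ n * Complex.exp (x * Complex.I) := by
    induction n with
    | zero => simp
    | succ n ih =>
      rw [iteratedDeriv_succ, ih]
      funext x
      have h : HasDerivAt (fun x : ℝ => Complex.exp (x * Complex.I))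
          (Complex.exp (x * Complex.I) * (1 * Complex.I)) x :=
        (Complex.ofRealCLM.hasDerivAt.mul_const Complex.I).cexp
      rw [(h.const_mul (Complex.I ^ n)).deriv]
      ring
  refine ⟨?_, fun n => ⟨0, 1, fun x => ?_⟩⟩
  · exact (Complex.ofRealCLM.contDiff.mul contDiff_const).cexp
  · rw [norm_iteratedFDeriv_eq_norm_iteratedDeriv, hder]
    simp [Complex.norm_exp_ofReal_mul_I]

/-- Quadratic forms on `ℝᴺ` have temperate growth. -/
theorem hasTemperateGrowth_dotProduct_mulVec_s4 {N : ℕ} (Q : Matrix (Fin N) (Fin N) ℝ) :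
    Function.HasTemperateGrowth (fun t : Fin N → ℝ => t ⬝ᵥ (Q *ᵥ t)) := by
  have hc (i : Fin N) : Function.HasTemperateGrowth (fun t : Fin N → ℝ => t i) :=
    (ContinuousLinearMap.proj (R := ℝ) (φ := fun _ : Fin N => ℝ) i).hasTemperateGrowth
  simp only [dotProduct, Matrix.mulVec]
  exact .sum fun i _ => (hc i).fun_mul
    (.sum fun j _ => (Function.HasTemperateGrowth.const _).fun_mul (hc j))

/-- The exponential `exp (πi t Q tᵀ)` of a quadratic form has temperate growth. -/
theorem hasTemperateGrowth_chirp_s4 {N : ℕ} (Q : Matrix (Fin N) (Fin N) ℝ) :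
    Function.HasTemperateGrowth (fun t : Fin N → ℝ =>
      Complex.exp (((Real.pi * (t ⬝ᵥ (Q *ᵥ t)) : ℝ) : ℂ) * Complex.I)) :=
  hasTemperateGrowth_cexp_ofReal_mul_I_s4.comp
    ((Function.HasTemperateGrowth.const _).fun_mul (hasTemperateGrowth_dotProduct_mulVec_s4 Q))

/-- The Fourier integral of a Schwartz function on `ℝᴺ`, precomposed with an invertible matrix,
is integrable. -/
theorem SchwartzMap.integrable_fourierIntegral_mulVec {N : ℕ} (P : Matrix (Fin N) (Fin N) ℝ)
    (hP : P.det ≠ 0) (h : SchwartzMap (Fin N → ℝ) ℂ) :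
    Integrable (fun u : Fin N → ℝ => ∫ t : Fin N → ℝ,
      h t * Complex.exp (-(2 * ↑Real.pi * Complex.I * ↑(t ⬝ᵥ (P *ᵥ u))))) := by
  let e := EuclideanSpace.equiv (Fin N) ℝ
  let p : (Fin N → ℝ) ≃L[ℝ] (Fin N → ℝ) :=
    (LinearEquiv.ofIsUnitDet (f := Matrix.toLin' P) (v := Pi.basisFun ℝ (Fin N))
      (v' := Pi.basisFun ℝ (Fin N)) (by
        rw [LinearMap.toMatrix_eq_toMatrix', LinearMap.toMatrix'_toLin']
        simpa using hP)).toContinuousLinearEquiv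
  let F := SchwartzMap.compCLMOfContinuousLinearEquiv ℂ (p.trans e.symm)
    (FourierTransform.fourier (SchwartzMap.compCLMOfContinuousLinearEquiv ℂ e h))
  refine F.integrable.congr (.of_forall fun u => ?_)
  have hp : p u = P *ᵥ u := rfl
  simp only [F, SchwartzMap.compCLMOfContinuousLinearEquiv_apply, Function.comp_apply,
    SchwartzMap.fourier_coe, Real.fourier_eq']
  rw [← (PiLp.volume_preserving_toLp (Fin N)).integral_comp
    (MeasurableEquiv.toLp 2 _).measurableEmbedding]
  refine integral_congr_ae (.of_forall fun t => ?_)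
  have hin : inner ℝ (WithLp.toLp 2 t) ((p.trans e.symm) u) = t ⬝ᵥ (P *ᵥ u) := by
    rw [← hp, EuclideanSpace.inner_eq_star_dotProduct, dotProduct_comm]
    rfl
  have he : e (WithLp.toLp 2 t) = t := rfl
  simp only [hin, he, smul_eq_mul]
  rw [mul_comm]
  congr 2
  push_cast
  ring

/-- The free metaplectic transform as a chirp times a Fourier integral. -/
theorem fmt_eq_chirp_mul {N : ℕ} (A B D : Matrix (Fin N) (Fin N) ℝ)
    (f : (Fin N → ℝ) → ℂ) (u : Fin N → ℝ) :
    fmt A B D f u = (((Real.sqrt |B.det|)⁻¹ : ℝ) : ℂ) *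
      (Complex.exp (((Real.pi * (u ⬝ᵥ ((D * B⁻¹) *ᵥ u)) : ℝ) : ℂ) * Complex.I) *
        ∫ t : Fin N → ℝ,
          (Complex.exp (((Real.pi * (t ⬝ᵥ ((B⁻¹ * A) *ᵥ t)) : ℝ) : ℂ) * Complex.I) * f t) *
            Complex.exp (-(2 * ↑Real.pi * Complex.I * ↑(t ⬝ᵥ (B⁻¹ *ᵥ u))))) := by
  rw [fmt, ← integral_const_mul (Complex.exp _)]
  congr 2
  funext t
  rw [show ∀ a b c x : ℂ, a * (b * x * c) = x * (a * b * c) by intros; ring,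
    ← Complex.exp_add, ← Complex.exp_add]
  congr 2
  push_cast
  ring

/-- The free metaplectic transform of a Schwartz function is integrable. -/
theorem integrable_fmt {N : ℕ} (A B D : Matrix (Fin N) (Fin N) ℝ) (hB : B.det ≠ 0)
    (g : SchwartzMap (Fin N → ℝ) ℂ) : Integrable (fmt A B D g) := by
  have hP : (B⁻¹).det ≠ 0 := by
    rw [Matrix.det_nonsing_inv, Ring.inverse_eq_inv']
    exact inv_ne_zero hB
  have key := SchwartzMap.integrable_fourierIntegral_mulVec B⁻¹ hP
    (SchwartzMap.smulLeftCLM ℂ (fun t : Fin N → ℝ =>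
      Complex.exp (((Real.pi * (t ⬝ᵥ ((B⁻¹ * A) *ᵥ t)) : ℝ) : ℂ) * Complex.I)) g)
  simp only [SchwartzMap.smulLeftCLM_apply_apply (hasTemperateGrowth_chirp_s4 (B⁻¹ * A)),
    smul_eq_mul] at key
  have hfun := funext (fmt_eq_chirp_mul A B D g)
  rw [hfun]
  refine Integrable.const_mul (key.bdd_mul (c := 1) ?_ (.of_forall fun u => ?_)) _
  · exact (hasTemperateGrowth_chirp_s4 (D * B⁻¹)).1.continuous.aestronglyMeasurable
  · exact (Complex.norm_exp_ofReal_mul_I _).le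

/-- Transposing the matrix of a bilinear form swaps its arguments. -/
theorem dotProduct_transpose_mulVec_comm_s4 {N : ℕ} (Q : Matrix (Fin N) (Fin N) ℝ)
    (u v : Fin N → ℝ) : u ⬝ᵥ (Qᵀ *ᵥ v) = v ⬝ᵥ (Q *ᵥ u) := by
  rw [Matrix.mulVec_transpose, dotProduct_comm, Matrix.dotProduct_mulVec]

/-- The first free metaplectic convolution
`z(t) = ∫ f(τ) g(t θ τ) dτ` is recovered by the inverse FMT of the product of spectra:
`z(t) = |det B|^(−1/2) ∫ L_M[f](u) L_M[g](u) · exp(−πi(u B⁻ᵀ Dᵀ uᵀ + t Aᵀ B⁻ᵀ tᵀ) + 2πi u B⁻ᵀ tᵀ) du`. -/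
theorem fmt_convolution_first_kind_inversion {N : ℕ} (A B C D : Matrix (Fin N) (Fin N) ℝ)
    (h1 : A * Bᵀ = B * Aᵀ) (h2 : C * Dᵀ = D * Cᵀ)
    (h3 : A * Dᵀ - B * Cᵀ = 1) (hB : B.det ≠ 0)
    (f g : SchwartzMap ((Fin N) → ℝ) ℂ) (t : Fin N → ℝ) :
    (∫ τ : Fin N → ℝ, f τ * genTrans A B D (⇑g) t τ)
      = (((Real.sqrt |B.det|)⁻¹ : ℝ) : ℂ) *
        ∫ u : Fin N → ℝ,
          fmt A B D (⇑f) u * fmt A B D (⇑g) u *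
            Complex.exp (-(↑Real.pi * Complex.I *
                (↑(u ⬝ᵥ (((B⁻¹)ᵀ * Dᵀ) *ᵥ u)) + ↑(t ⬝ᵥ ((Aᵀ * (B⁻¹)ᵀ) *ᵥ t))))
              + 2 * ↑Real.pi * Complex.I * ↑(u ⬝ᵥ ((B⁻¹)ᵀ *ᵥ t))) := by
  have hs : (((Real.sqrt |B.det|)⁻¹ : ℝ) : ℂ) * (((Real.sqrt |B.det|)⁻¹ : ℝ) : ℂ) =
      ((|B.det|⁻¹ : ℝ) : ℂ) := by
    rw [← Complex.ofReal_mul, ← mul_inv, Real.mul_self_sqrt (abs_nonneg _)]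
  let K : (Fin N → ℝ) → (Fin N → ℝ) → ℝ := fun τ u =>
    Real.pi * (τ ⬝ᵥ ((B⁻¹ * A) *ᵥ τ) - t ⬝ᵥ ((B⁻¹ * A) *ᵥ t))
      + 2 * Real.pi * ((t - τ) ⬝ᵥ (B⁻¹ *ᵥ u))
  have hK (τ u : Fin N → ℝ) : Complex.exp (↑Real.pi * Complex.I *
          (↑(τ ⬝ᵥ ((B⁻¹ * A) *ᵥ τ)) - ↑(t ⬝ᵥ ((B⁻¹ * A) *ᵥ t)))
        + 2 * ↑Real.pi * Complex.I * ↑((t - τ) ⬝ᵥ (B⁻¹ *ᵥ u))) =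
      Complex.exp ((K τ u : ℂ) * Complex.I) := by
    congr 1
    simp only [K]
    push_cast
    ring
  have hint : Integrable (Function.uncurry fun τ u : Fin N → ℝ =>
      Complex.exp ((K τ u : ℂ) * Complex.I) * (f τ * fmt A B D g u))
      (volume.prod volume) := by
    refine (f.integrable.mul_prod (integrable_fmt A B D hB g)).bdd_mul (c := 1) ?_
      (.of_forall fun _ => (Complex.norm_exp_ofReal_mul_I _).le)
    apply Continuous.aestronglyMeasurable
    simp only [K]
    fun_prop
  calc (∫ τ : Fin N → ℝ, f τ * genTrans A B D (⇑g) t τ)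
      = ((|B.det|⁻¹ : ℝ) : ℂ) * ∫ τ : Fin N → ℝ, ∫ u : Fin N → ℝ,
          Complex.exp ((K τ u : ℂ) * Complex.I) * (f τ * fmt A B D g u) := by
        simp only [genTrans, hK]
        rw [← integral_const_mul]
        refine integral_congr_ae (.of_forall fun τ => ?_)
        beta_reduce
        rw [mul_left_comm, ← integral_const_mul]
        congr 2
        funext u
        ring
    _ = ((|B.det|⁻¹ : ℝ) : ℂ) * ∫ u : Fin N → ℝ, ∫ τ : Fin N → ℝ,
          Complex.exp ((K τ u : ℂ) * Complex.I) * (f τ * fmt A B D g u) := by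
        rw [integral_integral_swap hint]
    _ = _ := by
        rw [← hs, mul_assoc, ← integral_const_mul]
        congr 2
        funext u
        rw [fmt_eq_chirp_mul A B D f u, ← Matrix.transpose_mul, ← Matrix.transpose_mul,
          dotProduct_transpose_mulVec_comm_s4, dotProduct_transpose_mulVec_comm_s4,
          dotProduct_transpose_mulVec_comm_s4]
        rw [show ∀ a b x y z : ℂ, a * (b * x) * y * z = a * (b * y * z * x) by intros; ring]
        congr 1
        rw [← integral_const_mul]
        congr 1
        funext τ
        rw [show ∀ a b c d x y : ℂ, a * y * b * (c * x * d) = a * b * c * d * (x * y) by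
          intros; ring, ← Complex.exp_add, ← Complex.exp_add, ← Complex.exp_add]
        congr 2
        simp only [K, sub_dotProduct]
        push_cast
        ring
end

section
/- Let M = [[A,B],[C,D]] be a 2N×2N real free symplectic matrix (A·Bᵀ = B·Aᵀ, C·Dᵀ = D·Cᵀ, A·Dᵀ − B·Cᵀ = I_N, det B ≠ 0) and let f, g : ℝᴺ → ℂ be Schwartz functions. Then the FMT of the pointwise product equals the first free metaplectic convolution (taken with respect to the generalized translation induced by the inverse matrix M⁻¹ = [[Dᵀ, −Bᵀ],[−Cᵀ, Aᵀ]]) of the two FMT spectra: for every u ∈ ℝᴺ, L_M[f·g](u) = ∫_{ℝᴺ} L_M[f](τ) · (L_M[g])(u θ' τ) dτ, where (L_M[g])(u θ' τ) = |det B|^(−1) ∫_{ℝᴺ} g(t) · exp(πi (u B⁻ᵀ Dᵀ uᵀ − τ B⁻ᵀ Dᵀ τᵀ) + 2πi (τ − u) B⁻ᵀ tᵀ) dt. -/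
open MeasureTheory Matrix Complex

/-- The spectral generalized translation of the FMT spectrum of `g` by `τ`,
built from the kernel of the inverse transform `L_{M⁻¹}`:
`(L_M[g])(u θ' τ) = |det B|⁻¹ ∫ g(t) · exp(πi(u B⁻ᵀ Dᵀ uᵀ − τ B⁻ᵀ Dᵀ τᵀ) + 2πi (τ−u) B⁻ᵀ tᵀ) dt`. -/
noncomputable def spectralGenTrans {N : ℕ} (B D : Matrix (Fin N) (Fin N) ℝ)
    (g : (Fin N → ℝ) → ℂ) (u τ : Fin N → ℝ) : ℂ :=
  ((|B.det|⁻¹ : ℝ) : ℂ) *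
    ∫ t : Fin N → ℝ,
      g t * Complex.exp (↑Real.pi * Complex.I *
          (↑(u ⬝ᵥ (((B⁻¹)ᵀ * Dᵀ) *ᵥ u)) - ↑(τ ⬝ᵥ (((B⁻¹)ᵀ * Dᵀ) *ᵥ τ)))
        + 2 * ↑Real.pi * Complex.I * ↑((τ - u) ⬝ᵥ ((B⁻¹)ᵀ *ᵥ t)))

/-- The Fourier transform on `ι → ℝ` with respect to the dot product is self-adjoint. -/
lemma integral_fourier_dotProduct_mul_eq {ι : Type*} [Fintype ι] {F G : (ι → ℝ) → ℂ}
    (hF : Integrable F) (hG : Integrable G) :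
    ∫ w : ι → ℝ, (∫ s : ι → ℝ, F s * cexp (-(2 * Real.pi * I * ↑(s ⬝ᵥ w)))) * G w
      = ∫ s : ι → ℝ, F s * ∫ w : ι → ℝ, G w * cexp (-(2 * Real.pi * I * ↑(s ⬝ᵥ w))) := by
  have key := VectorFourier.integral_fourierIntegral_smul_eq_flip
    (μ := (volume : Measure (ι → ℝ))) (ν := (volume : Measure (ι → ℝ)))
    (L := (dotProductBilin ℝ ℝ : (ι → ℝ) →ₗ[ℝ] (ι → ℝ) →ₗ[ℝ] ℝ))
    Real.continuous_fourierChar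
    (by
      change Continuous fun p : (ι → ℝ) × (ι → ℝ) => p.1 ⬝ᵥ p.2
      fun_prop) hF hG
  have hexp (x : ℝ) (z : ℂ) :
      Real.fourierChar (-x) • z = z * cexp (-(2 * Real.pi * I * ↑x)) := by
    rw [Circle.smul_def, Real.fourierChar_apply, smul_eq_mul, mul_comm]
    congr 2
    push_cast
    ring
  simpa only [VectorFourier.fourierIntegral, LinearMap.flip_apply, dotProductBilin_apply_apply,
    hexp, smul_eq_mul] using key

/-- Fourier inversion on `ι → ℝ` with respect to the dot product, for Schwartz functions. -/
lemma SchwartzMap.integrable_and_fourier_fourierInv_dotProduct {ι : Type*} [Fintype ι]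
    (g : SchwartzMap (ι → ℝ) ℂ) :
    Integrable (fun w : ι → ℝ => ∫ t : ι → ℝ, g t * cexp (2 * Real.pi * I * ↑(t ⬝ᵥ w))) ∧
    ∀ s : ι → ℝ, ∫ w : ι → ℝ, (∫ t : ι → ℝ, g t * cexp (2 * Real.pi * I * ↑(t ⬝ᵥ w))) *
      cexp (-(2 * Real.pi * I * ↑(s ⬝ᵥ w))) = g s := by
  let e : EuclideanSpace ℝ ι ≃L[ℝ] (ι → ℝ) := EuclideanSpace.equiv ι ℝ
  let g' : SchwartzMap (EuclideanSpace ℝ ι) ℂ :=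
    SchwartzMap.compCLMOfContinuousLinearEquiv ℂ e g
  have hvp := PiLp.volume_preserving_toLp ι
  have hemb := (MeasurableEquiv.toLp 2 (ι → ℝ)).measurableEmbedding
  have hinv (w : ι → ℝ) : FourierTransformInv.fourierInv g' (WithLp.toLp 2 w)
      = ∫ t : ι → ℝ, g t * cexp (2 * Real.pi * I * ↑(t ⬝ᵥ w)) := by
    rw [SchwartzMap.fourierInv_coe, Real.fourierInv_eq', ← hvp.integral_comp hemb]
    refine integral_congr_ae (.of_forall fun t => ?_)
    simp only [smul_eq_mul, EuclideanSpace.inner_toLp_toLp, star_trivial]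
    change _ * g t = _
    rw [mul_comm, dotProduct_comm w t]
    congr 2
    push_cast
    ring
  constructor
  · exact ((hvp.integrable_comp_emb hemb).2
      (FourierTransformInv.fourierInv g').integrable).congr (.of_forall hinv)
  · intro s
    have h : FourierTransform.fourier (FourierTransformInv.fourierInv g') (WithLp.toLp 2 s)
        = g' (WithLp.toLp 2 s) := by
      rw [FourierTransform.fourier_fourierInv_eq]
    rw [SchwartzMap.fourier_coe, Real.fourier_eq', ← hvp.integral_comp hemb] at h
    refine Eq.trans (integral_congr_ae (.of_forall fun w => ?_)) h
    simp only [smul_eq_mul, EuclideanSpace.inner_toLp_toLp, star_trivial, hinv]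
    rw [mul_comm]
    congr 2
    push_cast
    ring

/-- The Fourier transform of a product with a Schwartz function as a convolution of spectra. -/
lemma SchwartzMap.integral_fourier_mul_fourierInv_sub {ι : Type*} [Fintype ι]
    (g : SchwartzMap (ι → ℝ) ℂ) {F : (ι → ℝ) → ℂ} (hF : Integrable F) (w₀ : ι → ℝ) :
    ∫ w : ι → ℝ, (∫ s : ι → ℝ, F s * cexp (-(2 * Real.pi * I * ↑(s ⬝ᵥ w)))) *
        ∫ t : ι → ℝ, g t * cexp (2 * Real.pi * I * ↑(t ⬝ᵥ (w - w₀)))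
      = ∫ s : ι → ℝ, F s * g s * cexp (-(2 * Real.pi * I * ↑(s ⬝ᵥ w₀))) := by
  obtain ⟨hG, hinv⟩ := g.integrable_and_fourier_fourierInv_dotProduct
  rw [integral_fourier_dotProduct_mul_eq hF (hG.comp_sub_right w₀)]
  refine integral_congr_ae (.of_forall fun s => ?_)
  beta_reduce
  rw [← hinv s, mul_assoc (F s), ← integral_mul_const]
  congr 1
  refine Eq.trans (integral_congr_ae (.of_forall fun w => ?_))
    (integral_sub_right_eq_self _ w₀)
  beta_reduce
  rw [mul_assoc _ (cexp _) (cexp _), ← Complex.exp_add]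
  congr 2
  rw [dotProduct_sub]
  push_cast
  ring

/-- Linear change of variables for integrals over `ι → ℝ`. -/
lemma integral_comp_inv_mulVec {ι : Type*} [Fintype ι] [DecidableEq ι] {B : Matrix ι ι ℝ}
    (hB : B.det ≠ 0) (φ : (ι → ℝ) → ℂ) :
    ∫ τ : ι → ℝ, φ (B⁻¹ *ᵥ τ) = ((|B.det| : ℝ) : ℂ) * ∫ w : ι → ℝ, φ w := by
  have hB' : (B⁻¹).det ≠ 0 := by
    rw [det_nonsing_inv, Ring.inverse_eq_inv']
    exact inv_ne_zero hB
  have hinj : Function.Injective (toLin' B⁻¹) :=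
    mulVec_injective_of_isUnit ((isUnit_iff_isUnit_det _).2 hB'.isUnit)
  have hemb := (toLin' B⁻¹).continuous_of_finiteDimensional.measurableEmbedding hinj
  have h := hemb.integral_map (μ := volume) φ
  rw [Real.map_matrix_volume_pi_eq_smul_volume_pi hB', integral_smul_measure,
    ENNReal.toReal_ofReal (abs_nonneg _), det_nonsing_inv, Ring.inverse_eq_inv', inv_inv,
    Complex.real_smul] at h
  exact h.symm

/-- The FMT of the pointwise product equals the first free metaplectic
convolution (with respect to the generalized translation induced by `M⁻¹`) of the spectra:
`L_M[f·g](u) = ∫ L_M[f](τ) · (L_M[g])(u θ' τ) dτ`. -/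
theorem fmt_product_theorem {N : ℕ} (A B C D : Matrix (Fin N) (Fin N) ℝ)
    (h1 : A * Bᵀ = B * Aᵀ) (h2 : C * Dᵀ = D * Cᵀ)
    (h3 : A * Dᵀ - B * Cᵀ = 1) (hB : B.det ≠ 0)
    (f g : SchwartzMap ((Fin N) → ℝ) ℂ) (u : Fin N → ℝ) :
    fmt A B D (fun t => f t * g t) u
      = ∫ τ : Fin N → ℝ, fmt A B D (⇑f) τ * spectralGenTrans B D (⇑g) u τ := by
  have hf : Integrable fun t : Fin N → ℝ =>
      f t * cexp (Real.pi * I * ↑(t ⬝ᵥ ((B⁻¹ * A) *ᵥ t))) := by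
    refine f.integrable.mul_bdd (c := 1) (by fun_prop) (.of_forall fun t => ?_)
    rw [mul_right_comm, ← Complex.ofReal_mul, Complex.norm_exp_ofReal_mul_I]
  have hquad (v : Fin N → ℝ) : v ⬝ᵥ (((B⁻¹)ᵀ * Dᵀ) *ᵥ v) = v ⬝ᵥ ((D * B⁻¹) *ᵥ v) := by
    rw [← transpose_mul, mulVec_transpose, dotProduct_comm, ← dotProduct_mulVec]
  set q : ℂ := ↑(u ⬝ᵥ ((D * B⁻¹) *ᵥ u))
  have hfmt (h : (Fin N → ℝ) → ℂ) (τ : Fin N → ℝ) : fmt A B D h τ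
      = (((Real.sqrt |B.det|)⁻¹ : ℝ) : ℂ) * (cexp (Real.pi * I * ↑(τ ⬝ᵥ ((D * B⁻¹) *ᵥ τ))) *
        ∫ s : Fin N → ℝ, h s * cexp (Real.pi * I * ↑(s ⬝ᵥ ((B⁻¹ * A) *ᵥ s))) *
          cexp (-(2 * Real.pi * I * ↑(s ⬝ᵥ (B⁻¹ *ᵥ τ))))) := by
    rw [fmt]
    congr 1
    rw [← integral_const_mul]
    refine integral_congr_ae (.of_forall fun s => ?_)
    beta_reduce
    rw [sub_eq_add_neg, mul_add, Complex.exp_add, Complex.exp_add]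
    ring
  have hspec (τ : Fin N → ℝ) : spectralGenTrans B D g u τ
      = ((|B.det|⁻¹ : ℝ) : ℂ) * (cexp (Real.pi * I * q) *
        cexp (-(Real.pi * I * ↑(τ ⬝ᵥ ((D * B⁻¹) *ᵥ τ)))) *
        ∫ t : Fin N → ℝ, g t *
          cexp (2 * Real.pi * I * ↑(t ⬝ᵥ (B⁻¹ *ᵥ τ - B⁻¹ *ᵥ u)))) := by
    rw [spectralGenTrans]
    congr 1
    rw [← integral_const_mul]
    refine integral_congr_ae (.of_forall fun t => ?_)
    beta_reduce
    rw [hquad, hquad, mulVec_transpose, dotProduct_comm (τ - u), ← dotProduct_mulVec, mulVec_sub,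
      Complex.exp_add, mul_sub, sub_eq_add_neg, Complex.exp_add]
    ring
  have hdet : ((|B.det| : ℝ) : ℂ) ≠ 0 := by exact_mod_cast abs_ne_zero.2 hB
  let Φ : (Fin N → ℝ) → ℂ := fun w =>
    (∫ s : Fin N → ℝ, f s * cexp (Real.pi * I * ↑(s ⬝ᵥ ((B⁻¹ * A) *ᵥ s))) *
      cexp (-(2 * Real.pi * I * ↑(s ⬝ᵥ w)))) *
    ∫ t : Fin N → ℝ, g t * cexp (2 * Real.pi * I * ↑(t ⬝ᵥ (w - B⁻¹ *ᵥ u)))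
  have hΦ : ∫ w, Φ w = _ := g.integral_fourier_mul_fourierInv_sub hf (B⁻¹ *ᵥ u)
  have hprod (τ : Fin N → ℝ) : fmt A B D f τ * spectralGenTrans B D g u τ
      = (((Real.sqrt |B.det|)⁻¹ : ℝ) : ℂ) * ((|B.det|⁻¹ : ℝ) : ℂ) * cexp (Real.pi * I * q) *
        Φ (B⁻¹ *ᵥ τ) := by
    rw [hfmt, hspec, Complex.exp_neg (Real.pi * I * _)]
    simp only [Φ]
    field_simp
  rw [integral_congr_ae (.of_forall hprod), integral_const_mul, integral_comp_inv_mulVec hB Φ,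
    hΦ, hfmt, Complex.ofReal_inv |B.det|]
  field_simp
  congr 2
  funext s
  ring
end
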